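/- A perfect matching M in a many-to-many instance G = (A ∪ B, E) is a popular perfect matching if and only if there exists a one-to-one realization M' of M such that every alternating cycle C with respect to M' in the instance G'_{M'} satisfies wt_{M'}(C) ≤ 0. -/

import Mathlib

/-- Vote of a vertex comparing a neighbor of rank `x` with a neighbor of rank `y`
(lower rank = more preferred). -/
def vsgn (x y : ℕ) : ℤ := if x < y then 1 else if y < x then -1 else 0

/-- Vote in the cloned instance: clone preferences are lexicographic, first by the
rank of the underlying vertex, then by the clone index (lower index preferred). -/
def lsgn (r j r' j' : ℕ) : ℤ :=
  if r < r' ∨ (r = r' ∧ j < j') then 1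
  else if r' < r ∨ (r' = r ∧ j' < j) then -1 else 0

/-- The clones of the vertices of `A`: vertex `a` is replaced by `cap a` clones. -/
abbrev Clones {A : Type*} (cap : A → ℕ) : Type _ := (a : A) × Fin (cap a)

/-- `M(a)`, the set of jobs matched to agent `a`. -/
def jobsOf {A B : Type*} [DecidableEq A] [DecidableEq B]
    (M : Finset (A × B)) (a : A) : Finset B :=
  (M.filter (fun e => e.1 = a)).image Prod.snd

/-- `M(b)`, the set of agents matched to job `b`. -/
def agentsOf {A B : Type*} [DecidableEq A] [DecidableEq B]
    (M : Finset (A × B)) (b : B) : Finset A :=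
  (M.filter (fun e => e.2 = b)).image Prod.fst

/-- The set of possible values `∑_{u ∈ S} vote(u, σ u)` over bijections `σ : S ≃ T`;
the vote `vote_v(S,T)` of the paper is the least element of this set. -/
def voteSet {B : Type*} (r : B → ℕ) (S T : Finset B) : Set ℤ :=
  {z | ∃ σ : {x // x ∈ S} ≃ {x // x ∈ T},
    z = ∑ x : {x // x ∈ S}, vsgn (r x.1) (r ((σ x).1))}

/-- A perfect matching in the many-to-many instance: `M ⊆ E` and every vertex `v`
is matched to exactly `cap v` partners. -/
def IsPerfect {A B : Type*} [DecidableEq A] [DecidableEq B]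
    (E M : Finset (A × B)) (capA : A → ℕ) (capB : B → ℕ) : Prop :=
  M ⊆ E ∧ (∀ a, (M.filter (fun e => e.1 = a)).card = capA a) ∧
    ∀ b, (M.filter (fun e => e.2 = b)).card = capB b

/-- `M` is a popular perfect matching: `M` is perfect and `Δ(M,N) ≥ 0` for every
perfect matching `N`, where each vertex votes using the most adversarial bijection
between `M(v) \ N(v)` and `N(v) \ M(v)`.  Since the minima at distinct vertices are
independent, `Δ(M,N) ≥ 0` is equivalent to: every choice of one vote value per
vertex sums to a nonnegative number. -/
def PopularPerfect {A B : Type*} [Fintype A] [Fintype B] [DecidableEq A] [DecidableEq B]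
    (E : Finset (A × B)) (capA : A → ℕ) (capB : B → ℕ)
    (rA : A → B → ℕ) (rB : B → A → ℕ) (M : Finset (A × B)) : Prop :=
  IsPerfect E M capA capB ∧
    ∀ N : Finset (A × B), IsPerfect E N capA capB →
      ∀ za : A → ℤ, ∀ zb : B → ℤ,
        (∀ a, za a ∈ voteSet (rA a) (jobsOf M a \ jobsOf N a) (jobsOf N a \ jobsOf M a)) →
        (∀ b, zb b ∈ voteSet (rB b) (agentsOf M b \ agentsOf N b) (agentsOf N b \ agentsOf M b)) →
        0 ≤ (∑ a, za a) + ∑ b, zb b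

/-- `M'` is a one-to-one realization of the many-to-many matching `M` in the cloned
instance: every `M'`-edge projects to an `M`-edge, and distinct clones of the same
agent are matched to clones of distinct jobs (so each `M`-edge is used once). -/
def Realizes {A B : Type*} {capA : A → ℕ} {capB : B → ℕ}
    (M' : Clones capA ≃ Clones capB) (M : Finset (A × B)) : Prop :=
  (∀ x, (x.1, (M' x).1) ∈ M) ∧
    ∀ x y : Clones capA, x ≠ y → x.1 = y.1 → (M' x).1 ≠ (M' y).1

/-- The edge set `E'_{M'}` of the instance `G'_{M'}`: the edges of `M'` together
with all clone-copies of edges of `E \ M`. -/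
def inEM {A B : Type*} [DecidableEq A] [DecidableEq B] {capA : A → ℕ} {capB : B → ℕ}
    (E M : Finset (A × B)) (M' : Clones capA ≃ Clones capB)
    (x : Clones capA) (y : Clones capB) : Prop :=
  M' x = y ∨ ((x.1, y.1) ∈ E ∧ (x.1, y.1) ∉ M)

/-- `wt_{M'}(x,y) = vote_x(y, M'(x)) + vote_y(x, M'(y))` in the cloned instance. -/
def wtEdge {A B : Type*} {capA : A → ℕ} {capB : B → ℕ}
    (rA : A → B → ℕ) (rB : B → A → ℕ) (M' : Clones capA ≃ Clones capB)
    (x : Clones capA) (y : Clones capB) : ℤ :=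
  lsgn (rA x.1 y.1) y.2 (rA x.1 (M' x).1) (M' x).2 +
    lsgn (rB y.1 x.1) x.2 (rB y.1 (M'.symm y).1) (M'.symm y).2

/-- An alternating cycle with respect to the (perfect one-to-one) matching `M'`,
with non-matching edges taken from the edge relation `Edge`: the cycle visits the
distinct clones `f 0, g 0, f 1, g 1, …` cyclically, `(f t, g t)` being `M'`-edges
and `(f (t+1), g t)` being non-matching edges of the instance. -/
structure AltCycle {A B : Type*} {capA : A → ℕ} {capB : B → ℕ}
    (M' : Clones capA ≃ Clones capB)
    (Edge : Clones capA → Clones capB → Prop) where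
  m : ℕ
  f : Fin (m + 2) → Clones capA
  g : Fin (m + 2) → Clones capB
  hf : Function.Injective f
  hg : Function.Injective g
  hmatch : ∀ t, M' (f t) = g t
  hnonmatch : ∀ t, M' (f (t + 1)) ≠ g t
  hedge : ∀ t, Edge (f (t + 1)) (g t)

/-- The weight `wt_{M'}(C)` of an alternating cycle: the sum of the weights of all
its edges. -/
def AltCycle.wt {A B : Type*} {capA : A → ℕ} {capB : B → ℕ}
    {M' : Clones capA ≃ Clones capB} {Edge : Clones capA → Clones capB → Prop}
    (C : AltCycle M' Edge) (rA : A → B → ℕ) (rB : B → A → ℕ) : ℤ :=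
  ∑ t : Fin (C.m + 2),
    (wtEdge rA rB M' (C.f t) (C.g t) + wtEdge rA rB M' (C.f (t + 1)) (C.g t))

/-- A cycle is valid if no two of its non-matching edges are clone-copies of the
same edge of `G` (matching edges are automatically distinct copies). -/
def AltCycle.Valid {A B : Type*} {capA : A → ℕ} {capB : B → ℕ}
    {M' : Clones capA ≃ Clones capB} {Edge : Clones capA → Clones capB → Prop}
    (C : AltCycle M' Edge) : Prop :=
  Function.Injective (fun t : Fin (C.m + 2) => ((C.f (t + 1)).1, (C.g t).1))

/-- A permutation of a finite type splits along an invariant predicate. -/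
theorem Equiv.Perm.exists_split_of_invariant {X : Type*} [Finite X] (π : Equiv.Perm X)
    (p : X → Prop) (hp : ∀ x, p x → p (π x)) :
    ∃ σ τ : Equiv.Perm X, ∀ x, (p x → σ x = π x ∧ τ x = x) ∧ (¬ p x → σ x = x ∧ τ x = π x) := by
  classical
  have hmaps : Set.MapsTo π {x | p x} {x | p x} := hp
  have hsurj : Set.SurjOn π {x | p x} {x | p x} :=
    ((Set.toFinite _).surjOn_iff_bijOn_of_mapsTo hmaps).2
      (((Set.toFinite _).injOn_iff_bijOn_of_mapsTo hmaps).1 π.injective.injOn)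
  have hiff : ∀ x, p (π x) ↔ p x := fun x => ⟨fun h => by
    obtain ⟨y, hy, hyx⟩ := hsurj h
    exact π.injective hyx ▸ hy, hp x⟩
  have hiff' : ∀ x, ¬ p (π x) ↔ ¬ p x := fun x => not_congr (hiff x)
  refine ⟨Equiv.Perm.ofSubtype (π.subtypePerm hiff), Equiv.Perm.ofSubtype (π.subtypePerm (p := fun x => ¬ p x) hiff'),
    fun x => ⟨fun h => ⟨?_, ?_⟩, fun h => ⟨?_, ?_⟩⟩⟩
  · rw [Equiv.Perm.ofSubtype_apply_of_mem _ h]; rfl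
  · rw [Equiv.Perm.ofSubtype_apply_of_not_mem (p := fun x => ¬ p x) _ (not_not.2 h)]
  · rw [Equiv.Perm.ofSubtype_apply_of_not_mem _ h]
  · rw [Equiv.Perm.ofSubtype_apply_of_mem (p := fun x => ¬ p x) _ h]; rfl

theorem vsgn_self (x : ℕ) : vsgn x x = 0 := by simp [vsgn]

theorem vsgn_neg (x y : ℕ) : -vsgn x y = vsgn y x := by
  unfold vsgn; split_ifs <;> omega

theorem lsgn_self (r j : ℕ) : lsgn r j r j = 0 := by simp [lsgn]

theorem lsgn_of_ne {r r' : ℕ} (h : r ≠ r') (j j' : ℕ) : lsgn r j r' j' = vsgn r r' := by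
  unfold lsgn vsgn; split_ifs <;> omega

section Perm

variable {A B : Type*}
  {capA : A → ℕ} {capB : B → ℕ}

/-- The one-to-one matching pairing `π x` with `M' x` uses, outside `M'`, only copies of edges
of `E \ M`. -/
def Admissible (E M : Finset (A × B)) (M' : Clones capA ≃ Clones capB)
    (π : Equiv.Perm (Clones capA)) : Prop :=
  ∀ x, π x = x ∨ (((π x).1, (M' x).1) ∈ E ∧ ((π x).1, (M' x).1) ∉ M)

/-- The votes of the two ends of the non-matching edge between `z` and `M' x`, comparing that
edge with the realization `M'` by the ranks of the underlying vertices. -/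
def moveWt (rA : A → B → ℕ) (rB : B → A → ℕ) (M' : Clones capA ≃ Clones capB)
    (x z : Clones capA) : ℤ :=
  vsgn (rA z.1 (M' x).1) (rA z.1 (M' z).1) + vsgn (rB (M' x).1 z.1) (rB (M' x).1 x.1)

/-- The weight of the one-to-one matching pairing `π x` with `M' x`. -/
def permWt [Fintype A] (rA : A → B → ℕ) (rB : B → A → ℕ) (M' : Clones capA ≃ Clones capB)
    (π : Equiv.Perm (Clones capA)) : ℤ :=
  ∑ x, moveWt rA rB M' x (π x)

variable {rA : A → B → ℕ} {rB : B → A → ℕ} {E M : Finset (A × B)}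
  {M' : Clones capA ≃ Clones capB} {π : Equiv.Perm (Clones capA)}

theorem moveWt_self (x : Clones capA) : moveWt rA rB M' x x = 0 := by
  simp [moveWt, vsgn_self]

theorem wtEdge_self (x : Clones capA) : wtEdge rA rB M' x (M' x) = 0 := by
  have h := M'.symm_apply_apply x
  unfold wtEdge
  generalize M'.symm (M' x) = w at h ⊢
  subst h
  simp [lsgn_self]

theorem wtEdge_eq_moveWt (hrA : ∀ a, Function.Injective (rA a))
    (hrB : ∀ b, Function.Injective (rB b)) (hM' : Realizes M' M) {x z : Clones capA}
    (h : (z.1, (M' x).1) ∉ M) : wtEdge rA rB M' z (M' x) = moveWt rA rB M' x z := by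
  unfold wtEdge moveWt
  rw [lsgn_of_ne, lsgn_of_ne, Equiv.symm_apply_apply]
  · rw [Equiv.symm_apply_apply]
    exact fun e => h (hrB _ e ▸ hM'.1 x)
  · exact fun e => h (hrA _ e ▸ hM'.1 z)

theorem Admissible.of_apply_eq_or {σ : Equiv.Perm (Clones capA)} (hπ : Admissible E M M' π)
    (h : ∀ x, σ x = π x ∨ σ x = x) : Admissible E M M' σ := fun x => by
  rcases h x with h | h
  · rw [h]; exact hπ x
  · exact Or.inl h

theorem Admissible.exists_split [Fintype A] [DecidableEq A] (hπ : Admissible E M M' π)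
    (p : Clones capA → Prop) (hp : ∀ x, p x → p (π x)) {x y : Clones capA}
    (hx : p x) (hy : ¬ p y) (hπx : π x ≠ x) (hπy : π y ≠ y) :
    ∃ σ τ : Equiv.Perm (Clones capA), Admissible E M M' σ ∧ Admissible E M M' τ ∧
      σ.support.card < π.support.card ∧ τ.support.card < π.support.card ∧
      permWt rA rB M' π = permWt rA rB M' σ + permWt rA rB M' τ := by
  obtain ⟨σ, τ, h⟩ := π.exists_split_of_invariant p hp
  have hσ : ∀ z, σ z = π z ∨ σ z = z := fun z => by
    by_cases hz : p z
    · exact Or.inl ((h z).1 hz).1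
    · exact Or.inr ((h z).2 hz).1
  have hτ : ∀ z, τ z = π z ∨ τ z = z := fun z => by
    by_cases hz : p z
    · exact Or.inr ((h z).1 hz).2
    · exact Or.inl ((h z).2 hz).2
  have hcard : ∀ (ρ : Equiv.Perm (Clones capA)) (w : Clones capA),
      (∀ z, ρ z = π z ∨ ρ z = z) → ρ w = w → π w ≠ w → ρ.support.card < π.support.card := by
    intro ρ w hρ hw hw'
    apply Finset.card_lt_card
    rw [Finset.ssubset_iff_of_subset]
    · exact ⟨w, by simpa using hw', by simpa using hw⟩
    · intro z hz
      rw [Equiv.Perm.mem_support] at hz ⊢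
      rcases hρ z with e | e
      · rwa [← e]
      · exact absurd e hz
  refine ⟨σ, τ, hπ.of_apply_eq_or hσ, hπ.of_apply_eq_or hτ, hcard σ y hσ ((h y).2 hy).1 hπy,
    hcard τ x hτ ((h x).1 hx).2 hπx, ?_⟩
  unfold permWt
  rw [← Finset.sum_add_distrib]
  refine Finset.sum_congr rfl fun z _ => ?_
  by_cases hz : p z
  · rw [((h z).1 hz).1, ((h z).1 hz).2, moveWt_self, add_zero]
  · rw [((h z).2 hz).1, ((h z).2 hz).2, moveWt_self, zero_add]

theorem permWt_nonpos_of_altCycle [Fintype A] [DecidableEq A] [DecidableEq B]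
    (hrA : ∀ a, Function.Injective (rA a)) (hrB : ∀ b, Function.Injective (rB b))
    (hM' : Realizes M' M) (hC : ∀ C : AltCycle M' (inEM E M M'), C.wt rA rB ≤ 0)
    (hπ : Admissible E M M' π) : permWt rA rB M' π ≤ 0 := by
  induction hn : π.support.card using Nat.strong_induction_on generalizing π with
  | _ n ih =>
  by_cases hid : ∀ x, π x = x
  · simp [permWt, hid, moveWt_self]
  push Not at hid
  obtain ⟨x, hx⟩ := hid
  by_cases hsplit : ∃ y, (∀ i : ℕ, y ≠ π^[i] x) ∧ π y ≠ y
  · obtain ⟨y, hy, hπy⟩ := hsplit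
    obtain ⟨σ, τ, hσ, hτ, hcσ, hcτ, hsum⟩ := hπ.exists_split (rA := rA) (rB := rB)
      (fun z => ∃ i : ℕ, z = π^[i] x)
      (fun z ⟨i, hi⟩ => ⟨i + 1, by rw [Function.iterate_succ_apply', hi]⟩)
      (x := x) (y := y) ⟨0, rfl⟩ (by push Not; exact hy) hx hπy
    rw [hsum]
    exact add_nonpos (ih _ (hn ▸ hcσ) hσ rfl) (ih _ (hn ▸ hcτ) hτ rfl)
  push Not at hsplit
  have hpos : 0 < Function.minimalPeriod π x :=
    Function.minimalPeriod_pos_of_mem_periodicPts (π.injective.mem_periodicPts x)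
  have hone : Function.minimalPeriod π x ≠ 1 := fun h =>
    hx (Function.minimalPeriod_eq_one_iff_isFixedPt.1 h)
  obtain ⟨m, hm⟩ : ∃ m, Function.minimalPeriod π x = m + 2 :=
    ⟨Function.minimalPeriod π x - 2, by omega⟩
  let f : Fin (m + 2) → Clones capA := fun t => π^[t] x
  have hf : Function.Injective f := fun s t hst =>
    Fin.ext (Function.iterate_injOn_Iio_minimalPeriod
      (by simp [hm]) (by simp [hm]) hst)
  have hsucc : ∀ t, f (t + 1) = π (f t) := fun t => by
    change π^[(t + 1 : Fin (m + 2))] x = π (π^[t] x)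
    have hval : ((t + 1 : Fin (m + 2)) : ℕ) = (t + 1) % Function.minimalPeriod π x := by
      rw [Fin.val_add, hm]; simp
    rw [← Function.iterate_succ_apply' (f := π), hval, Function.iterate_mod_minimalPeriod_eq]
  have hne : ∀ t, f (t + 1) ≠ f t := fun t h => by
    have := congrArg Fin.val (hf h)
    rw [Fin.val_add_one] at this
    split_ifs at this with hlast
    · rw [hlast] at this; simp at this
    · omega
  have hedge : ∀ t, ((f (t + 1)).1, (M' (f t)).1) ∈ E ∧ ((f (t + 1)).1, (M' (f t)).1) ∉ M :=
    fun t => by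
      have h := hπ (f t)
      rw [← hsucc] at h
      exact h.resolve_left (hne t)
  have hwt := hC
    { m := m, f := f, g := fun t => M' (f t), hf := hf, hg := M'.injective.comp hf,
      hmatch := fun _ => rfl, hnonmatch := fun t h => hne t (M'.injective h),
      hedge := fun t => Or.inr (hedge t) }
  refine le_of_eq_of_le ?_ hwt
  symm
  refine Fintype.sum_of_injective f hf _ _ (fun z hz => ?_) (fun t => ?_)
  · rw [hsplit z fun i hi => hz ⟨⟨i % (m + 2), Nat.mod_lt _ (by omega)⟩, ?_⟩, moveWt_self]
    change π^[i % (m + 2)] x = z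
    rw [← hm, Function.iterate_mod_minimalPeriod_eq, hi]
  · change wtEdge rA rB M' (f t) (M' (f t)) + wtEdge rA rB M' (f (t + 1)) (M' (f t)) = _
    rw [wtEdge_self, zero_add, wtEdge_eq_moveWt hrA hrB hM' (hedge t).2, hsucc]

/-- It suffices to bound the weight of permutations that use at most one copy of each edge: two
copies of the same edge can be exchanged, without changing the weight, to split a cycle. -/
theorem permWt_nonpos_of_injective [Fintype A] [DecidableEq A]
    (hM' : Realizes M' M)
    (hs : ∀ σ, Admissible E M M' σ → Function.Injective (fun x => ((σ x).1, (M' x).1)) →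
      permWt rA rB M' σ ≤ 0)
    (hπ : Admissible E M M' π) : permWt rA rB M' π ≤ 0 := by
  induction hn : π.support.card using Nat.strong_induction_on generalizing π with
  | _ n ih =>
  by_cases hinj : Function.Injective (fun x => ((π x).1, (M' x).1))
  · exact hs π hπ hinj
  simp only [Function.Injective, Prod.mk.injEq, not_forall] at hinj
  obtain ⟨x, y, ⟨hA, hB⟩, hxy⟩ := hinj
  have hfix : ∀ {u v : Clones capA}, (π u).1 = (π v).1 → (M' u).1 = (M' v).1 → u ≠ v →
      π u ≠ u := by
    intro u v h₁ h₂ huv hu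
    rcases hπ v with hv | hv
    · rw [hu, hv] at h₁
      exact hM'.2 u v huv h₁ h₂
    · apply hv.2
      rw [← h₁, ← h₂, hu]
      exact hM'.1 u
  have hx : π x ≠ x := hfix hA hB hxy
  have hy : π y ≠ y := hfix hA.symm hB.symm (Ne.symm hxy)
  by_cases horb : ∃ i : ℕ, π^[i] x = y
  · classical
    let k := Nat.find horb
    have hk : π^[k] x = y := Nat.find_spec horb
    have hmin : ∀ i < k, π^[i] x ≠ y := fun i hi => Nat.find_min horb hi
    have hk0 : k ≠ 0 := fun h => hxy (by rw [← hk, h]; rfl)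
    let ρ : Equiv.Perm (Clones capA) := π * Equiv.swap x y
    have hρx : ρ x = π y := by simp [ρ]
    have hρy : ρ y = π x := by simp [ρ]
    have hρ : ∀ z, z ≠ x → z ≠ y → ρ z = π z := fun z h₁ h₂ => by
      simp [ρ, Equiv.swap_apply_of_ne_of_ne h₁ h₂]
    have hπx := (hπ x).resolve_left hx
    have hπy := (hπ y).resolve_left hy
    have hρadm : Admissible E M M' ρ := fun z => by
      by_cases h₁ : z = x
      · rw [h₁, hρx, ← hA]; exact Or.inr hπx
      by_cases h₂ : z = y
      · rw [h₂, hρy, hA]; exact Or.inr hπy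
      rw [hρ z h₁ h₂]; exact hπ z
    have hmoved : ∀ u, ((ρ u).1, (M' u).1) ∉ M → ρ u ≠ u := fun u h e => h (by
      rw [e]; exact hM'.1 u)
    have hρx' : ρ x ≠ x := hmoved x (by rw [hρx, ← hA]; exact hπx.2)
    have hρy' : ρ y ≠ y := hmoved y (by rw [hρy, hA]; exact hπy.2)
    have hnx : ∀ i, 0 < i → i ≤ k → π^[i] x ≠ x := fun i hi hik h => by
      apply hmin (k - i) (by omega)
      rw [← hk]
      conv_rhs => rw [show k = k - i + i by omega, Function.iterate_add_apply, h]
    obtain ⟨σ, τ, hσ, hτ, hcσ, hcτ, hsum⟩ := hρadm.exists_split (rA := rA) (rB := rB)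
      (fun z => ∃ i, 0 < i ∧ i ≤ k ∧ z = π^[i] x)
      (by
        rintro z ⟨i, hi, hik, rfl⟩
        rcases hik.eq_or_lt with rfl | hlt
        · exact ⟨1, one_pos, hi, by rw [hk, hρy]; rfl⟩
        · refine ⟨i + 1, by omega, by omega, ?_⟩
          rw [hρ _ (hnx i hi hik) (hmin i hlt), Function.iterate_succ_apply'])
      (x := y) (y := x) ⟨k, by omega, le_rfl, hk.symm⟩
      (by rintro ⟨i, hi, hik, h⟩; exact hnx i hi hik h.symm) hρy' hρx'
    have hsupp : ρ.support.card ≤ π.support.card := by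
      refine Finset.card_le_card fun z hz => ?_
      rw [Equiv.Perm.mem_support] at hz ⊢
      by_cases h₁ : z = x
      · rwa [h₁]
      by_cases h₂ : z = y
      · rwa [h₂]
      rwa [hρ z h₁ h₂] at hz
    have hwt : permWt rA rB M' π = permWt rA rB M' ρ := by
      unfold permWt moveWt
      simp only [Finset.sum_add_distrib]
      congr 1
      · refine (Equiv.sum_comp π.symm _).symm.trans
          ((Finset.sum_congr rfl fun z _ => ?_).trans (Equiv.sum_comp ρ.symm _))
        simp only [Equiv.apply_symm_apply]
        have : (M' (ρ.symm z)).1 = (M' (π.symm z)).1 := by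
          have e : ρ.symm z = Equiv.swap x y (π.symm z) := by
            rw [Equiv.symm_apply_eq]; simp [ρ]
          rw [e, Equiv.swap_apply_def]
          split_ifs with h₁ h₂
          · rw [h₁, hB]
          · rw [h₂, hB]
          · rfl
        rw [this]
      · refine Finset.sum_congr rfl fun z _ => ?_
        have : (ρ z).1 = (π z).1 := by
          by_cases h₁ : z = x
          · rw [h₁, hρx, hA]
          by_cases h₂ : z = y
          · rw [h₂, hρy, hA]
          rw [hρ z h₁ h₂]
        rw [this]
    rw [hwt, hsum]
    exact add_nonpos (ih _ (by omega) hσ rfl) (ih _ (by omega) hτ rfl)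
  · obtain ⟨σ, τ, hσ, hτ, hcσ, hcτ, hsum⟩ := hπ.exists_split (rA := rA) (rB := rB)
      (fun z => ∃ i : ℕ, π^[i] x = z)
      (fun z ⟨i, hi⟩ => ⟨i + 1, by rw [Function.iterate_succ_apply', hi]⟩)
      (x := x) (y := y) ⟨0, rfl⟩ horb hx hy
    rw [hsum]
    exact add_nonpos (ih _ (hn ▸ hcσ) hσ rfl) (ih _ (hn ▸ hcτ) hτ rfl)

theorem AltCycle.wt_nonpos_of_permWt_nonpos [Fintype A] [DecidableEq A] [DecidableEq B]
    (hrA : ∀ a, Function.Injective (rA a)) (hrB : ∀ b, Function.Injective (rB b))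
    (hM' : Realizes M' M) (hπ : ∀ π, Admissible E M M' π → permWt rA rB M' π ≤ 0)
    (C : AltCycle M' (inEM E M M')) : C.wt rA rB ≤ 0 := by
  classical
  let e := Equiv.ofInjective C.f C.hf
  let π : Equiv.Perm (Clones capA) := (finRotate (C.m + 2)).extendDomain e
  have hf : ∀ t, π (C.f t) = C.f (t + 1) := fun t => by
    have h := Equiv.Perm.extendDomain_apply_image (finRotate (C.m + 2)) e t
    rw [finRotate_apply] at h
    exact h
  have hout : ∀ x, x ∉ Set.range C.f → π x = x := fun x hx =>
    Equiv.Perm.extendDomain_apply_not_subtype _ e hx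
  have hedge : ∀ t, ((C.f (t + 1)).1, (C.g t).1) ∈ E ∧ ((C.f (t + 1)).1, (C.g t).1) ∉ M :=
    fun t => (C.hedge t).resolve_left (C.hnonmatch t)
  refine le_of_eq_of_le ?_ (hπ π fun x => ?_)
  · refine Fintype.sum_of_injective C.f C.hf _ _ (fun x hx => ?_) (fun t => ?_)
    · rw [hout x hx, moveWt_self]
    · have h := (hedge t).2
      rw [← C.hmatch] at h
      rw [← C.hmatch, wtEdge_self, zero_add, wtEdge_eq_moveWt hrA hrB hM' h, hf]
  · by_cases hx : x ∈ Set.range C.f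
    · obtain ⟨t, rfl⟩ := hx
      rw [hf, C.hmatch]
      exact Or.inr (hedge t)
    · exact Or.inl (hout x hx)

end Perm

theorem sum_mem_voteSet {ι V : Type*} [DecidableEq V] (r : V → ℕ) {S T : Finset V}
    (Z : Finset ι) (p q : ι → V) (hp : Set.InjOn p Z) (hq : Set.InjOn q Z)
    (hS : Z.image p = S) (hT : Z.image q = T) :
    ∑ z ∈ Z, vsgn (r (p z)) (r (q z)) ∈ voteSet r S T := by
  subst hS hT
  have key : ∀ f : ι → V, Set.InjOn f Z →
      ∃ e : {z // z ∈ Z} ≃ {v // v ∈ Z.image f}, ∀ z, (e z).1 = f z := fun f hf =>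
    ⟨Equiv.ofBijective (fun z => ⟨f z, Finset.mem_image_of_mem f z.2⟩)
      ⟨fun x y h => Subtype.ext (hf x.2 y.2 (congrArg Subtype.val h)), fun ⟨v, hv⟩ => by
        obtain ⟨z, hz, rfl⟩ := Finset.mem_image.1 hv
        exact ⟨⟨z, hz⟩, rfl⟩⟩, fun _ => rfl⟩
  obtain ⟨eP, hP⟩ := key p hp
  obtain ⟨eQ, hQ⟩ := key q hq
  refine ⟨eP.symm.trans eQ, ?_⟩
  rw [← Equiv.sum_comp eP, ← Finset.sum_coe_sort]
  exact Finset.sum_congr rfl fun z _ => by simp [hP, hQ]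

/-- Bijections realizing vote values at all vertices glue to one bijection. -/
theorem exists_equiv_of_mem_voteSet {K V D D' : Type*} [Fintype K] [Fintype D]
    (r : K → V → ℕ) (S T : K → Finset V) (eS : D ≃ (k : K) × {v // v ∈ S k})
    (eT : D' ≃ (k : K) × {v // v ∈ T k}) (z : K → ℤ) (hz : ∀ k, z k ∈ voteSet (r k) (S k) (T k)) :
    ∃ ψ : D ≃ D', (∀ d, (eT (ψ d)).1 = (eS d).1) ∧
      ∑ k, z k = ∑ d, vsgn (r (eS d).1 (eS d).2.1) (r (eS d).1 (eT (ψ d)).2.1) := by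
  choose σ hσ using hz
  refine ⟨eS.trans ((Equiv.sigmaCongrRight σ).trans eT.symm), fun d => by simp, ?_⟩
  have h : ∀ d, eT ((eS.trans ((Equiv.sigmaCongrRight σ).trans eT.symm)) d) =
      Equiv.sigmaCongrRight σ (eS d) := fun d => by simp
  refine Eq.trans ?_ (Finset.sum_congr rfl fun d _ => by rw [h])
  rw [Equiv.sum_comp eS (fun s => vsgn (r s.1 s.2.1) (r s.1 (Equiv.sigmaCongrRight σ s).2.1)),
    Fintype.sum_sigma]
  exact Finset.sum_congr rfl fun k _ => hσ k

section Popular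

variable {A B : Type*} [DecidableEq A] [DecidableEq B] {capA : A → ℕ} {capB : B → ℕ}
  {rA : A → B → ℕ} {rB : B → A → ℕ} {E M N : Finset (A × B)} {M' : Clones capA ≃ Clones capB}

theorem mem_jobsOf {a : A} {b : B} : b ∈ jobsOf M a ↔ (a, b) ∈ M := by
  simp [jobsOf]

theorem mem_agentsOf {a : A} {b : B} : a ∈ agentsOf M b ↔ (a, b) ∈ M := by
  simp [agentsOf]

theorem card_filter_clones {K : Type*} [Fintype K] [DecidableEq K] {cap : K → ℕ} (a : K) :
    (Finset.univ.filter fun x : Clones cap => x.1 = a).card = cap a := by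
  rw [← Fintype.card_subtype, Fintype.card_congr (Equiv.sigmaSubtype a), Fintype.card_fin]

theorem IsPerfect.exists_realizes (hM : IsPerfect E M capA capB) :
    ∃ M' : Clones capA ≃ Clones capB, Realizes M' M := by
  have hA : ∃ u : Clones capA ≃ {e // e ∈ M}, ∀ x, (u x).1.1 = x.1 := by
    let u : ∀ a, Fin (capA a) ≃ {e : {e // e ∈ M} // e.1.1 = a} := fun a =>
      (Finset.equivFinOfCardEq (hM.2.1 a)).symm.trans
        { toFun := fun e => ⟨⟨e.1, (Finset.mem_filter.1 e.2).1⟩, (Finset.mem_filter.1 e.2).2⟩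
          invFun := fun e => ⟨e.1.1, Finset.mem_filter.2 ⟨e.1.2, e.2⟩⟩
          left_inv := fun _ => rfl
          right_inv := fun _ => rfl }
    exact ⟨(Equiv.sigmaCongrRight u).trans (Equiv.sigmaFiberEquiv _), fun x => (u x.1 x.2).2⟩
  have hB : ∃ u : Clones capB ≃ {e // e ∈ M}, ∀ x, (u x).1.2 = x.1 := by
    let u : ∀ b, Fin (capB b) ≃ {e : {e // e ∈ M} // e.1.2 = b} := fun b =>
      (Finset.equivFinOfCardEq (hM.2.2 b)).symm.trans
        { toFun := fun e => ⟨⟨e.1, (Finset.mem_filter.1 e.2).1⟩, (Finset.mem_filter.1 e.2).2⟩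
          invFun := fun e => ⟨e.1.1, Finset.mem_filter.2 ⟨e.1.2, e.2⟩⟩
          left_inv := fun _ => rfl
          right_inv := fun _ => rfl }
    exact ⟨(Equiv.sigmaCongrRight u).trans (Equiv.sigmaFiberEquiv _), fun x => (u x.1 x.2).2⟩
  obtain ⟨uA, hA⟩ := hA
  obtain ⟨uB, hB⟩ := hB
  have h : ∀ x, (x.1, ((uA.trans uB.symm) x).1) = (uA x).1 := fun x => by
    refine Prod.ext (hA x).symm ?_
    rw [← hB]; simp
  refine ⟨uA.trans uB.symm, fun x => h x ▸ (uA x).2, fun x y hxy h₁ h₂ => hxy ?_⟩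
  apply uA.injective
  apply Subtype.ext
  rw [← h, ← h, h₁, h₂]

theorem Realizes.injective {A B : Type*} {capA : A → ℕ} {capB : B → ℕ} {M : Finset (A × B)}
    {M' : Clones capA ≃ Clones capB} (hM' : Realizes M' M) {x y : Clones capA} (h₁ : x.1 = y.1)
    (h₂ : (M' x).1 = (M' y).1) : x = y := by
  by_contra h
  exact hM'.2 x y h h₁ h₂

theorem Realizes.exists_of_mem [Fintype A] (hM : IsPerfect E M capA capB) (hM' : Realizes M' M)
    {e : A × B} (he : e ∈ M) : ∃ x : Clones capA, (x.1, (M' x).1) = e := by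
  have himg : Finset.univ.image (fun x : Clones capA => (x.1, (M' x).1)) = M := by
    apply Finset.eq_of_subset_of_card_le
    · intro e he
      obtain ⟨x, -, rfl⟩ := Finset.mem_image.1 he
      exact hM'.1 x
    · rw [Finset.card_image_of_injective, Finset.card_univ, Fintype.card_sigma,
        Finset.card_eq_sum_card_fiberwise (f := Prod.fst) (t := Finset.univ) (by simp)]
      · simp [hM.2.1]
      · exact fun x y h => hM'.injective (Prod.ext_iff.1 h).1 (Prod.ext_iff.1 h).2
  rw [← himg] at he
  obtain ⟨x, -, hx⟩ := Finset.mem_image.1 he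
  exact ⟨x, hx⟩

theorem PopularPerfect.permWt_nonpos [Fintype A] [Fintype B]
    (hpop : PopularPerfect E capA capB rA rB M) (hM' : Realizes M' M)
    {π : Equiv.Perm (Clones capA)} (hπ : Admissible E M M' π)
    (hinj : Function.Injective (fun x => ((π x).1, (M' x).1))) : permWt rA rB M' π ≤ 0 := by
  obtain ⟨hM, hpop⟩ := hpop
  let N : Finset (A × B) := Finset.univ.image (fun x : Clones capA => ((π x).1, (M' x).1))
  have hN : ∀ a b, (a, b) ∈ N ↔ ∃ x, (π x).1 = a ∧ (M' x).1 = b := by simp [N]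
  have hfilter : ∀ (p : A × B → Prop) [DecidablePred p], (N.filter p).card =
      (Finset.univ.filter fun x : Clones capA => p ((π x).1, (M' x).1)).card := fun p _ => by
    simp only [N, Finset.filter_image]
    exact Finset.card_image_of_injective _ hinj
  have hNperf : IsPerfect E N capA capB := by
    refine ⟨fun e he => ?_, fun a => ?_, fun b => ?_⟩
    · obtain ⟨x, -, rfl⟩ := Finset.mem_image.1 he
      rcases hπ x with h | h
      · rw [h]; exact hM.1 (hM'.1 x)
      · exact h.1
    · rw [hfilter, ← card_filter_clones (cap := capA) a]
      exact Finset.card_equiv π (by simp)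
    · rw [hfilter, ← card_filter_clones (cap := capB) b]
      exact Finset.card_equiv M' (by simp)
  have hmemM : ∀ a b, (a, b) ∈ M → ∃ x : Clones capA, x.1 = a ∧ (M' x).1 = b := fun a b h => by
    obtain ⟨x, hx⟩ := hM'.exists_of_mem hM h
    exact ⟨x, congrArg Prod.fst hx, congrArg Prod.snd hx⟩
  have hmoved : ∀ x, π x ≠ x → (x.1, (M' x).1) ∉ N := fun x hx h => by
    obtain ⟨y, h₁, h₂⟩ := (hN _ _).1 h
    rcases hπ y with hy | hy
    · rw [hy] at h₁
      exact hx (hM'.injective h₁ h₂ ▸ hy)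
    · apply hy.2
      rw [h₁, h₂]
      exact hM'.1 x
  let Z : Finset (Clones capA) := Finset.univ.filter fun x => π x ≠ x
  let Z' : Finset (Clones capA) := Finset.univ.filter fun x => π.symm x ≠ x
  have hZ' : ∀ x, π.symm x ≠ x ↔ π x ≠ x := fun x => by
    rw [ne_eq, ne_eq, Equiv.symm_apply_eq, eq_comm]
  have hA : ∀ a, ∑ z ∈ Z' with z.1 = a, vsgn (rA a (M' z).1) (rA a (M' (π.symm z)).1) ∈
      voteSet (rA a) (jobsOf M a \ jobsOf N a) (jobsOf N a \ jobsOf M a) := fun a => by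
    refine sum_mem_voteSet (rA a) _ (fun z => (M' z).1) (fun z => (M' (π.symm z)).1) ?_ ?_ ?_ ?_
    · intro x hx y hy h
      have hx := (Finset.mem_filter.1 hx).2
      have hy := (Finset.mem_filter.1 hy).2
      exact hM'.injective (hx.trans hy.symm) h
    · intro x hx y hy h
      have hx := (Finset.mem_filter.1 hx).2
      have hy := (Finset.mem_filter.1 hy).2
      apply π.symm.injective
      apply hinj
      simp only [Equiv.apply_symm_apply]
      exact Prod.ext (hx.trans hy.symm) h
    · ext b
      simp only [Finset.mem_image, Finset.mem_filter, Finset.mem_univ, true_and, Z', hZ',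
        Finset.mem_sdiff, mem_jobsOf]
      constructor
      · rintro ⟨x, ⟨hx, rfl⟩, rfl⟩
        exact ⟨hM'.1 x, hmoved x hx⟩
      · rintro ⟨h₁, h₂⟩
        obtain ⟨x, rfl, rfl⟩ := hmemM _ _ h₁
        refine ⟨x, ⟨fun h => h₂ ((hN _ _).2 ⟨x, by rw [h], rfl⟩), rfl⟩, rfl⟩
    · ext b
      simp only [Finset.mem_image, Finset.mem_filter, Finset.mem_univ, true_and, Z',
        Finset.mem_sdiff, mem_jobsOf]
      constructor
      · rintro ⟨x, ⟨hx, rfl⟩, rfl⟩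
        obtain ⟨y, rfl⟩ := π.surjective x
        rw [Equiv.symm_apply_apply] at hx ⊢
        exact ⟨(hN _ _).2 ⟨y, rfl, rfl⟩, ((hπ y).resolve_left hx.symm).2⟩
      · rintro ⟨h₁, h₂⟩
        obtain ⟨x, rfl, rfl⟩ := (hN _ _).1 h₁
        refine ⟨π x, ⟨fun h => h₂ ?_, rfl⟩, by simp⟩
        rw [Equiv.symm_apply_apply] at h
        rw [← h]
        exact hM'.1 x
  have hB : ∀ b, ∑ x ∈ Z with (M' x).1 = b, vsgn (rB b x.1) (rB b (π x).1) ∈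
      voteSet (rB b) (agentsOf M b \ agentsOf N b) (agentsOf N b \ agentsOf M b) := fun b => by
    refine sum_mem_voteSet (rB b) _ (fun x => x.1) (fun x => (π x).1) ?_ ?_ ?_ ?_
    · intro x hx y hy h
      have hx := (Finset.mem_filter.1 hx).2
      have hy := (Finset.mem_filter.1 hy).2
      exact hM'.injective h (hx.trans hy.symm)
    · intro x hx y hy h
      have hx := (Finset.mem_filter.1 hx).2
      have hy := (Finset.mem_filter.1 hy).2
      exact hinj (Prod.ext h (hx.trans hy.symm))
    · ext a
      simp only [Finset.mem_image, Finset.mem_filter, Finset.mem_univ, true_and, Z,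
        Finset.mem_sdiff, mem_agentsOf]
      constructor
      · rintro ⟨x, ⟨hx, rfl⟩, rfl⟩
        exact ⟨hM'.1 x, hmoved x hx⟩
      · rintro ⟨h₁, h₂⟩
        obtain ⟨x, rfl, rfl⟩ := hmemM _ _ h₁
        refine ⟨x, ⟨fun h => h₂ ((hN _ _).2 ⟨x, by rw [h], rfl⟩), rfl⟩, rfl⟩
    · ext a
      simp only [Finset.mem_image, Finset.mem_filter, Finset.mem_univ, true_and, Z,
        Finset.mem_sdiff, mem_agentsOf]
      constructor
      · rintro ⟨x, ⟨hx, rfl⟩, rfl⟩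
        exact ⟨(hN _ _).2 ⟨x, rfl, rfl⟩, ((hπ x).resolve_left hx).2⟩
      · rintro ⟨h₁, h₂⟩
        obtain ⟨x, rfl, rfl⟩ := (hN _ _).1 h₁
        refine ⟨x, ⟨fun h => h₂ ?_, rfl⟩, rfl⟩
        rw [h]
        exact hM'.1 x
  have hsumA : ∑ a, ∑ z ∈ Z' with z.1 = a, vsgn (rA a (M' z).1) (rA a (M' (π.symm z)).1) =
      ∑ z, vsgn (rA z.1 (M' z).1) (rA z.1 (M' (π.symm z)).1) := by
    rw [← Finset.sum_subset (Finset.subset_univ Z'), ← Finset.sum_fiberwise Z' Sigma.fst]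
    · refine Finset.sum_congr rfl fun a _ => Finset.sum_congr rfl fun z hz => ?_
      rw [(Finset.mem_filter.1 hz).2]
    · intro z _ hz
      have : π.symm z = z := by simpa [Z'] using hz
      rw [this, vsgn_self]
  have hsumB : ∑ b, ∑ x ∈ Z with (M' x).1 = b, vsgn (rB b x.1) (rB b (π x).1) =
      ∑ x, vsgn (rB (M' x).1 x.1) (rB (M' x).1 (π x).1) := by
    rw [← Finset.sum_subset (Finset.subset_univ Z),
      ← Finset.sum_fiberwise Z fun x => (M' x).1]
    · refine Finset.sum_congr rfl fun b _ => Finset.sum_congr rfl fun x hx => ?_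
      rw [(Finset.mem_filter.1 hx).2]
    · intro x _ hx
      have : π x = x := by simpa [Z] using hx
      rw [this, vsgn_self]
  have h := hpop N hNperf _ _ hA hB
  rw [hsumA, hsumB, ← Equiv.sum_comp π, ← Finset.sum_add_distrib] at h
  have hneg : permWt rA rB M' π = -∑ x, (vsgn (rA (π x).1 (M' (π x)).1)
      (rA (π x).1 (M' (π.symm (π x))).1) + vsgn (rB (M' x).1 x.1) (rB (M' x).1 (π x).1)) := by
    rw [← Finset.sum_neg_distrib]
    refine Finset.sum_congr rfl fun x _ => ?_
    rw [neg_add, vsgn_neg, vsgn_neg, Equiv.symm_apply_apply, moveWt]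
  omega

theorem PopularPerfect.of_permWt_nonpos [Fintype A] [Fintype B] (hM : IsPerfect E M capA capB)
    (hM' : Realizes M' M) (hπ : ∀ π, Admissible E M M' π → permWt rA rB M' π ≤ 0) :
    PopularPerfect E capA capB rA rB M := by
  refine ⟨hM, fun N hN za zb hza hzb => ?_⟩
  let eA (P Q : Finset (A × B)) : {e : A × B // e ∈ P ∧ e ∉ Q} ≃
      (a : A) × {b // b ∈ jobsOf P a \ jobsOf Q a} :=
    { toFun := fun e => ⟨e.1.1, e.1.2, by simpa [mem_jobsOf] using e.2⟩
      invFun := fun s => ⟨(s.1, s.2.1), by simpa [mem_jobsOf] using Finset.mem_sdiff.1 s.2.2⟩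
      left_inv := fun _ => rfl
      right_inv := fun _ => rfl }
  let eB (P Q : Finset (A × B)) : {e : A × B // e ∈ P ∧ e ∉ Q} ≃
      (b : B) × {a // a ∈ agentsOf P b \ agentsOf Q b} :=
    { toFun := fun e => ⟨e.1.2, e.1.1, by simpa [mem_agentsOf] using e.2⟩
      invFun := fun s => ⟨(s.2.1, s.1), by simpa [mem_agentsOf] using Finset.mem_sdiff.1 s.2.2⟩
      left_inv := fun _ => rfl
      right_inv := fun _ => rfl }
  obtain ⟨ψA, hψA, hsumA⟩ := exists_equiv_of_mem_voteSet rA _ _ (eA M N) (eA N M) za hza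
  obtain ⟨ψB, hψB, hsumB⟩ := exists_equiv_of_mem_voteSet rB _ _ (eB M N) (eB N M) zb hzb
  replace hψA : ∀ d, (ψA d).1.1 = d.1.1 := hψA
  replace hψB : ∀ d, (ψB d).1.2 = d.1.2 := hψB
  replace hsumA : ∑ a, za a = ∑ d, vsgn (rA d.1.1 d.1.2) (rA d.1.1 (ψA d).1.2) := hsumA
  replace hsumB : ∑ b, zb b = ∑ d, vsgn (rB d.1.2 d.1.1) (rB d.1.2 (ψB d).1.1) := hsumB
  let ε : {x : Clones capA // (x.1, (M' x).1) ∉ N} ≃ {e : A × B // e ∈ M ∧ e ∉ N} :=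
    Equiv.ofBijective (fun x => ⟨(x.1.1, (M' x.1).1), hM'.1 x.1, x.2⟩)
      ⟨fun x y h => Subtype.ext (hM'.injective (congrArg (fun e => e.1.1) h)
        (congrArg (fun e => e.1.2) h)), fun ⟨e, he, he'⟩ => by
          obtain ⟨x, rfl⟩ := hM'.exists_of_mem hM he
          exact ⟨⟨x, he'⟩, rfl⟩⟩
  have hε : ∀ d, ((ε.symm d).1.1, (M' (ε.symm d).1).1) = d.1 := fun d =>
    congrArg Subtype.val (ε.apply_symm_apply d)
  have hε₁ : ∀ d, (ε.symm d).1.1 = d.1.1 := fun d => congrArg Prod.fst (hε d)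
  have hε₂ : ∀ d, (M' (ε.symm d).1).1 = d.1.2 := fun d => congrArg Prod.snd (hε d)
  let ρ : Equiv.Perm {e : A × B // e ∈ M ∧ e ∉ N} := ψB.trans ψA.symm
  have hρ : ∀ d, ψA (ρ d) = ψB d := fun d => by simp [ρ]
  let π : Equiv.Perm (Clones capA) := ρ.extendDomain ε.symm
  have hπin : ∀ d, π (ε.symm d).1 = (ε.symm (ρ d)).1 := fun d =>
    Equiv.Perm.extendDomain_apply_image ρ ε.symm d
  have hπout : ∀ x : Clones capA, ¬ (x.1, (M' x).1) ∉ N → π x = x := fun x hx =>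
    Equiv.Perm.extendDomain_apply_not_subtype ρ ε.symm hx
  have hρψ : ∀ d, ((ρ d).1.1, d.1.2) = (ψB d).1 := fun d =>
    Prod.ext (by rw [← hρ, hψA]) (hψB d).symm
  have h := hπ π fun x => by
    by_cases hx : (x.1, (M' x).1) ∉ N
    · right
      have : x = (ε.symm (ε ⟨x, hx⟩)).1 := by simp
      rw [this, hπin, hε₁, hε₂, hρψ]
      exact ⟨hN.1 (ψB _).2.1, (ψB _).2.2⟩
    · exact Or.inl (hπout x hx)
  have hwt : permWt rA rB M' π = -((∑ a, za a) + ∑ b, zb b) := by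
    rw [hsumA, hsumB, ← Equiv.sum_comp ρ, ← Finset.sum_add_distrib, ← Finset.sum_neg_distrib]
    symm
    refine Fintype.sum_of_injective (fun d => (ε.symm d).1)
      (Subtype.val_injective.comp ε.symm.injective) _ _ (fun x hx => ?_) fun d => ?_
    · rw [hπout, moveWt_self]
      exact fun hxN => hx ⟨ε ⟨x, hxN⟩, by simp⟩
    · rw [neg_add, vsgn_neg, vsgn_neg, hπin, moveWt, hε₁, hε₁, hε₂, hε₂, hρ, hψB, ← hρψ]
  omega

end Popular

/-- Theorem 1 of the paper: a perfect matching `M` in a many-to-many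
instance `G = (A ∪ B, E)` is a popular perfect matching if and only if there is a
one-to-one realization `M'` of `M` such that every alternating cycle `C` w.r.t. `M'`
in the instance `G'_{M'}` satisfies `wt_{M'}(C) ≤ 0`. -/
theorem stmt7 {A B : Type*} [Fintype A] [Fintype B] [DecidableEq A] [DecidableEq B]
    (capA : A → ℕ) (capB : B → ℕ)
    (rA : A → B → ℕ) (rB : B → A → ℕ)
    (hrA : ∀ a, Function.Injective (rA a)) (hrB : ∀ b, Function.Injective (rB b))
    (E M : Finset (A × B)) (hM : IsPerfect E M capA capB) :
    PopularPerfect E capA capB rA rB M ↔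
      ∃ M' : Clones capA ≃ Clones capB, Realizes M' M ∧
        ∀ C : AltCycle M' (inEM E M M'), C.wt rA rB ≤ 0 := by
  constructor
  · intro hpop
    obtain ⟨M', hM'⟩ := hM.exists_realizes
    exact ⟨M', hM', AltCycle.wt_nonpos_of_permWt_nonpos hrA hrB hM' fun π hπ =>
      permWt_nonpos_of_injective hM' (fun _ hσ hinj => hpop.permWt_nonpos hM' hσ hinj) hπ⟩
  · rintro ⟨M', hM', hC⟩
    exact PopularPerfect.of_permWt_nonpos hM hM' fun π hπ =>
      permWt_nonpos_of_altCycle hrA hrB hM' hC hπ
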